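/- arXiv:1407.5397 — 2 statements merged into one kernel-verified Lean document; each statement's English description precedes it below -/
import Mathlib

section
/- There exists an indexed family of languages 𝓛 such that some CEGIS engine identifies 𝓛 but no HCEGIS engine identifies 𝓛; that is, CEGIS ⊄ HCEGIS. -/
/-- An indexed family of languages: a sequence of nonempty subsets of `ℕ` whose
two-argument membership predicate is decidable by a computable function. -/
def IsIndexedFamily (Lfam : ℕ → Set ℕ) : Prop :=
  (∀ i, (Lfam i).Nonempty) ∧
  ∃ f : ℕ → ℕ → Bool, Computable₂ f ∧ ∀ i n, f i n = true ↔ n ∈ Lfam i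

/-- A trace for a language `L` is a sequence of optional values whose set of
non-`none` values equals `L`. -/
def IsTrace (τ : ℕ → Option ℕ) (L : Set ℕ) : Prop :=
  {x : ℕ | ∃ n, τ n = some x} = L

/-- The candidate sequence of an engine with update function `F` and initial
index `p₀`, on trace `τ` and counterexample sequence `cex`. -/
def cand (F : ℕ → Option ℕ → Option ℕ → ℕ) (p₀ : ℕ) (τ cex : ℕ → Option ℕ) : ℕ → ℕ
  | 0 => p₀
  | n + 1 => F (cand F p₀ τ cex n) (τ n) (cex n)

/-- The update function of an engine is computable. -/
def EngineComputable (F : ℕ → Option ℕ → Option ℕ → ℕ) : Prop :=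
  Computable fun x : ℕ × Option ℕ × Option ℕ => F x.1 x.2.1 x.2.2

/-- Admissibility of a counterexample sequence for arbitrary counterexamples:
`cex n` is `none` when the `n`-th candidate language is a subset of the target
`L`, and otherwise is some element of the candidate language not in `L`. -/
def CexAdmissible (Lfam : ℕ → Set ℕ) (L : Set ℕ) (p : ℕ → ℕ) (cex : ℕ → Option ℕ) : Prop :=
  ∀ n, (Lfam (p n) ⊆ L → cex n = none) ∧
       (¬ Lfam (p n) ⊆ L → ∃ m, cex n = some m ∧ m ∈ Lfam (p n) \ L)

/-- Admissibility for minimal counterexamples: `cex n` is `none` when the `n`-th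
candidate language is a subset of `L`, and otherwise is the least element of the
candidate language minus `L`. -/
def MinCexAdmissible (Lfam : ℕ → Set ℕ) (L : Set ℕ) (p : ℕ → ℕ) (cex : ℕ → Option ℕ) : Prop :=
  ∀ n, (Lfam (p n) ⊆ L → cex n = none) ∧
       (¬ Lfam (p n) ⊆ L → cex n = some (sInf (Lfam (p n) \ L)))

/-- Admissibility for history bounded counterexamples: `cex n` is some element
`m` of the candidate language minus `L` with `m` strictly below some earlier
trace value, and `none` if no such element exists. -/
def HCexAdmissible (Lfam : ℕ → Set ℕ) (L : Set ℕ) (τ : ℕ → Option ℕ)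
    (p : ℕ → ℕ) (cex : ℕ → Option ℕ) : Prop :=
  ∀ n,
    ((∃ m, m ∈ Lfam (p n) \ L ∧ ∃ j ≤ n, ∃ v, τ j = some v ∧ m < v) →
      ∃ m, cex n = some m ∧ m ∈ Lfam (p n) \ L ∧ ∃ j ≤ n, ∃ v, τ j = some v ∧ m < v) ∧
    ((¬ ∃ m, m ∈ Lfam (p n) \ L ∧ ∃ j ≤ n, ∃ v, τ j = some v ∧ m < v) → cex n = none)

/-- The candidate sequence is eventually constant with a value indexing the
target language. -/
def ConvergesTo (Lfam : ℕ → Set ℕ) (L : Set ℕ) (p : ℕ → ℕ) : Prop :=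
  ∃ N j, Lfam j = L ∧ ∀ n ≥ N, p n = j

/-- A CEGIS engine identifies the language `L` of the family `Lfam`. -/
def CEGISIdentifies (F : ℕ → Option ℕ → Option ℕ → ℕ) (p₀ : ℕ)
    (Lfam : ℕ → Set ℕ) (L : Set ℕ) : Prop :=
  ∀ τ, IsTrace τ L → ∀ cex, CexAdmissible Lfam L (cand F p₀ τ cex) cex →
    ConvergesTo Lfam L (cand F p₀ τ cex)

/-- A MinCEGIS engine identifies the language `L` of the family `Lfam`. -/
def MinCEGISIdentifies (F : ℕ → Option ℕ → Option ℕ → ℕ) (p₀ : ℕ)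
    (Lfam : ℕ → Set ℕ) (L : Set ℕ) : Prop :=
  ∀ τ, IsTrace τ L → ∀ cex, MinCexAdmissible Lfam L (cand F p₀ τ cex) cex →
    ConvergesTo Lfam L (cand F p₀ τ cex)

/-- An HCEGIS engine identifies the language `L` of the family `Lfam`. -/
def HCEGISIdentifies (F : ℕ → Option ℕ → Option ℕ → ℕ) (p₀ : ℕ)
    (Lfam : ℕ → Set ℕ) (L : Set ℕ) : Prop :=
  ∀ τ, IsTrace τ L → ∀ cex, HCexAdmissible Lfam L τ (cand F p₀ τ cex) cex →
    ConvergesTo Lfam L (cand F p₀ τ cex)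

/-- The family `Lfam` is in the class CEGIS. -/
def InCEGIS (Lfam : ℕ → Set ℕ) : Prop :=
  ∃ F p₀, EngineComputable F ∧ ∀ i, CEGISIdentifies F p₀ Lfam (Lfam i)

/-- The family `Lfam` is in the class MinCEGIS. -/
def InMinCEGIS (Lfam : ℕ → Set ℕ) : Prop :=
  ∃ F p₀, EngineComputable F ∧ ∀ i, MinCEGISIdentifies F p₀ Lfam (Lfam i)

/-- The family `Lfam` is in the class HCEGIS. -/
def InHCEGIS (Lfam : ℕ → Set ℕ) : Prop :=
  ∃ F p₀, EngineComputable F ∧ ∀ i, HCEGISIdentifies F p₀ Lfam (Lfam i)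

/-- The initial segments of `ℕ`: index `0` stands for `ℕ` itself and index `i > 0` for
`{0, …, i - 1}`. -/
def initialSegment (i : ℕ) : Set ℕ := {n | i = 0 ∨ n < i}

theorem mem_initialSegment {i n : ℕ} : n ∈ initialSegment i ↔ i = 0 ∨ n < i := Iff.rfl

theorem initialSegment_injective : Function.Injective initialSegment := by
  intro i j h
  have hi := Set.ext_iff.1 h i
  have hj := Set.ext_iff.1 h j
  simp only [mem_initialSegment] at hi hj
  omega

theorem isIndexedFamily_initialSegment : IsIndexedFamily initialSegment := by
  refine ⟨fun i => ⟨0, by rw [mem_initialSegment]; omega⟩,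
    fun i n => decide (i = 0 ∨ n < i), ?_, by simp [mem_initialSegment]⟩
  have h : PrimrecPred fun x : ℕ × ℕ => x.1 = 0 ∨ x.2 < x.1 :=
    (Primrec.eq.comp Primrec.fst (Primrec.const 0)).or
      (Primrec.nat_lt.comp Primrec.snd Primrec.fst)
  exact h.decide.to_comp

/-- The engine that conjectures `ℕ` until it receives a counterexample, and then the least
initial segment containing the trace values read from then on. -/
def segmentEngine (p : ℕ) (t c : Option ℕ) : ℕ :=
  if p = 0 ∧ c = none then 0 else max (max p 1) (t.elim 0 Nat.succ)

theorem engineComputable_segmentEngine : EngineComputable segmentEngine := by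
  have hp : Primrec fun x : ℕ × Option ℕ × Option ℕ => x.1 := Primrec.fst
  have ht : Primrec fun x : ℕ × Option ℕ × Option ℕ => x.2.1 := Primrec.fst.comp Primrec.snd
  have hc : Primrec fun x : ℕ × Option ℕ × Option ℕ => x.2.2 := Primrec.snd.comp Primrec.snd
  have helim : Primrec fun x : ℕ × Option ℕ × Option ℕ => x.2.1.elim 0 Nat.succ :=
    (Primrec.option_casesOn ht (Primrec.const 0)
      (Primrec.succ.comp Primrec.snd).to₂).of_eq fun x => by cases x.2.1 <;> rfl
  have hcond : PrimrecPred fun x : ℕ × Option ℕ × Option ℕ => x.1 = 0 ∧ x.2.2 = none :=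
    (Primrec.eq.comp hp (Primrec.const 0)).and (Primrec.eq.comp hc (Primrec.const none))
  exact (Primrec.ite hcond (Primrec.const 0)
    (Primrec.nat_max.comp (Primrec.nat_max.comp hp (Primrec.const 1)) helim)).to_comp

theorem cegisIdentifies_segmentEngine (i : ℕ) :
    CEGISIdentifies segmentEngine 0 initialSegment (initialSegment i) := by
  intro τ hτ cex hcex
  set p := cand segmentEngine 0 τ cex with hp
  have p_zero : p 0 = 0 := rfl
  have p_succ (n : ℕ) : p (n + 1) = segmentEngine (p n) (τ n) (cex n) := rfl
  clear_value p
  have hmem (x : ℕ) : (∃ n, τ n = some x) ↔ i = 0 ∨ x < i := Set.ext_iff.1 hτ x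
  rcases Nat.eq_zero_or_pos i with rfl | hi
  · refine ⟨0, 0, rfl, fun n _ => ?_⟩
    induction n with
    | zero => exact p_zero
    | succ n ih =>
      have hc := (hcex n).1 fun x _ => Or.inl rfl
      simp [p_succ, segmentEngine, ih (Nat.zero_le _), hc]
  · have hc : cex 0 ≠ none := by
      obtain ⟨m, hm, -⟩ := (hcex 0).2 fun h => by
        have := @h i (by simp [p_zero, mem_initialSegment])
        rw [mem_initialSegment] at this
        omega
      simp [hm]
    have step (n : ℕ) (hn : n = 0 ∨ 0 < p n) :
        p (n + 1) = max (max (p n) 1) ((τ n).elim 0 Nat.succ) := by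
      rw [p_succ, segmentEngine, if_neg]
      rintro ⟨h1, h2⟩
      rcases hn with rfl | hn
      · exact hc h2
      · omega
    have helim (n : ℕ) : (τ n).elim 0 Nat.succ ≤ i := by
      cases h : τ n with
      | none => exact Nat.zero_le _
      | some v =>
        have := (hmem v).1 ⟨n, h⟩
        simp only [Option.elim]
        omega
    have bound (n : ℕ) : 0 < p (n + 1) ∧ p (n + 1) ≤ i := by
      induction n with
      | zero =>
        have := step 0 (Or.inl rfl)
        have := helim 0
        omega
      | succ n ih =>
        have := step (n + 1) (Or.inr ih.1)
        have := helim (n + 1)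
        omega
    obtain ⟨N, hN⟩ := (hmem (i - 1)).2 (by omega)
    refine ⟨N + 1, i, rfl, fun n hn => ?_⟩
    induction n, hn using Nat.le_induction with
    | base =>
      have h := step N (by cases N with
        | zero => exact Or.inl rfl
        | succ N => exact Or.inr (bound N).1)
      simp only [hN, Option.elim] at h
      have := bound N
      omega
    | succ n hn ih =>
      have := step n (Or.inr (by omega))
      have := bound n
      omega

/-- History bounded counterexamples to initial segments do not exist. -/
theorem hCexAdmissible_none {τ : ℕ → Option ℕ} {i : ℕ} (hτ : IsTrace τ (initialSegment i))
    (p : ℕ → ℕ) : HCexAdmissible initialSegment (initialSegment i) τ p fun _ => none := by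
  refine fun n => ⟨?_, fun _ => rfl⟩
  rintro ⟨m, ⟨-, hm⟩, j, -, v, hv, hmv⟩
  have hvi : v ∈ initialSegment i := hτ ▸ ⟨j, hv⟩
  rw [mem_initialSegment] at hm hvi
  omega

/-- The run of an engine without counterexamples, on the trace that repeats the value `v` until
the engine conjectures `{0, …, v}`, and then moves on to `v + 1`. The components are the current
candidate and the next trace value. -/
def adversarialRun (F : ℕ → Option ℕ → Option ℕ → ℕ) (p₀ : ℕ) : ℕ → ℕ × ℕ
  | 0 => (p₀, 0)
  | n + 1 =>
    let s := adversarialRun F p₀ n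
    let q := F s.1 (some s.2) none
    (q, if q = s.2 + 1 then s.2 + 1 else s.2)

theorem not_inHCEGIS_initialSegment : ¬ InHCEGIS initialSegment := by
  rintro ⟨F, p₀, -, hF⟩
  set v : ℕ → ℕ := fun n => (adversarialRun F p₀ n).2 with hv
  set τ : ℕ → Option ℕ := fun n => some (v n) with hτ
  set p := cand F p₀ τ fun _ => none with hp
  have p_eq (n : ℕ) : p n = (adversarialRun F p₀ n).1 := by
    induction n with
    | zero => rfl
    | succ n ih => simp only [hp, cand] at ih ⊢; rw [ih]; rfl
  have v_zero : v 0 = 0 := rfl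
  have v_succ (n : ℕ) : v (n + 1) = if p (n + 1) = v n + 1 then v n + 1 else v n := by
    rw [p_eq]; rfl
  have v_mono : Monotone v := monotone_nat_of_le_succ fun n => by
    rw [v_succ]; split_ifs <;> omega
  have v_surj (n : ℕ) : ∀ m ≤ v n, ∃ k, v k = m := by
    induction n with
    | zero => exact fun m hm => ⟨0, by omega⟩
    | succ n ih =>
      intro m hm
      by_cases h : m ≤ v n
      · exact ih m h
      · refine ⟨n + 1, ?_⟩
        rw [v_succ] at hm ⊢
        split_ifs at hm ⊢ <;> omega
  have converges (i : ℕ) (h : IsTrace τ (initialSegment i)) : ∃ N, ∀ n ≥ N, p n = i := by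
    obtain ⟨N, j, hj, hN⟩ := hF i τ h _ (hCexAdmissible_none h _)
    exact ⟨N, initialSegment_injective hj ▸ hN⟩
  by_cases hb : ∃ k, ∀ n, v n ≤ k
  · classical
    have hmax := Nat.find_spec hb
    have hmin : ∃ n, v n = Nat.find hb := by
      by_contra! hne
      have hpos : Nat.find hb ≠ 0 := fun h => hne 0 (by rw [h, v_zero])
      refine Nat.find_min hb (Nat.sub_one_lt hpos) fun n => ?_
      have := hmax n
      have := hne n
      omega
    generalize Nat.find hb = k at hmax hmin
    obtain ⟨n₀, hn₀⟩ := hmin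
    obtain ⟨N, hN⟩ := converges (k + 1) <| by
      ext x
      simp only [hτ, Set.mem_ofPred_eq, Option.some.injEq, mem_initialSegment]
      constructor
      · rintro ⟨n, rfl⟩
        have := hmax n
        omega
      · exact fun hx => v_surj n₀ x (by omega)
    have h1 : v (max n₀ N) = k := le_antisymm (hmax _) (hn₀ ▸ v_mono (le_max_left _ _))
    have h2 := v_succ (max n₀ N)
    rw [hN _ (by omega), h1, if_pos rfl] at h2
    have := hmax (max n₀ N + 1)
    omega
  · push Not at hb
    obtain ⟨N, hN⟩ := converges 0 <| by
      ext x
      obtain ⟨n, hn⟩ := hb x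
      simpa [hτ, mem_initialSegment] using v_surj n x hn.le
    obtain ⟨n, hn⟩ := hb (v N)
    have hconst (m : ℕ) (hm : N ≤ m) : v m = v N := by
      induction m, hm using Nat.le_induction with
      | base => rfl
      | succ m hm ih => rw [v_succ, hN _ (by omega), if_neg (by omega), ih]
    have := v_mono (le_max_left n N)
    have := hconst _ (le_max_right n N)
    omega

/-- CEGIS ⊄ HCEGIS. There is an indexed family identified by some
CEGIS engine but by no HCEGIS engine. -/
theorem cegis_not_subset_hcegis :
    ∃ Lfam : ℕ → Set ℕ, IsIndexedFamily Lfam ∧ InCEGIS Lfam ∧ ¬ InHCEGIS Lfam := by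
  exact ⟨initialSegment, isIndexedFamily_initialSegment,
    ⟨segmentEngine, 0, engineComputable_segmentEngine, cegisIdentifies_segmentEngine⟩,
    not_inHCEGIS_initialSegment⟩
end

section
/- There exists an indexed family of languages 𝓛 such that some HCEGIS engine identifies 𝓛 but no CEGIS engine identifies 𝓛; that is, HCEGIS ⊄ CEGIS. -/
/-- Indices of the separating family: `none`, `some none`, the column indices
`some (some (inl k))` and the tagged indices `some (some (inr (l, T)))`, where `T` is the binary
code of a finite set. -/
abbrev Idx := Option (Option (ℕ ⊕ ℕ × ℕ))

/-- The languages of the separating family. -/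
def lang : Idx → Set ℕ
  | none => {n | n = 0 ∨ n = 2 ∨ ∃ j, n = 3 * j + 4}
  | some none => {1}
  | some (some (Sum.inl k)) =>
      {n | n = 0 ∨ n = 1 ∨ (∃ j, n = 3 * j + 4) ∨ ∃ i, n = 3 * i + 3 ∧ i.unpair.1 = k}
  | some (some (Sum.inr (l, T))) =>
      {n | n = 0 ∨ n = 1 ∨ n = 2 ∨ n = 3 * l + 5 ∨ (∃ j, n = 3 * j + 4 ∧ j ≠ l.unpair.1) ∨
        ∃ i, n = 3 * i + 3 ∧ T.testBit i = true}

/-- The family `lang`, enumerated by natural numbers. -/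
def langFamily (i : ℕ) : Set ℕ := lang (Denumerable.ofNat Idx i)

/-- Boolean membership in the column languages. -/
def columnMem (k n : ℕ) : Bool :=
  decide (n = 0 ∨ n = 1 ∨ (n % 3 = 1 ∧ 3 ≤ n) ∨
    ((n % 3 = 0 ∧ 3 ≤ n) ∧ (n / 3 - 1).unpair.1 = k))

/-- Boolean membership in the tagged languages. -/
def taggedMem (p : ℕ × ℕ) (n : ℕ) : Bool :=
  decide (n = 0 ∨ n = 1 ∨ n = 2 ∨ n = 3 * p.1 + 5 ∨
    ((n % 3 = 1 ∧ 3 ≤ n) ∧ ¬ (n / 3 - 1) = p.1.unpair.1) ∨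
    ((n % 3 = 0 ∧ 3 ≤ n) ∧ p.2 / 2 ^ (n / 3 - 1) % 2 = 1))

/-- Boolean membership in the languages `lang`. -/
def langMem (a : Idx) (n : ℕ) : Bool :=
  Option.casesOn a (decide (n = 0 ∨ n = 2 ∨ (n % 3 = 1 ∧ 3 ≤ n)))
    fun o => Option.casesOn o (decide (n = 1))
      fun s => Sum.casesOn s (fun k => columnMem k n) (fun p => taggedMem p n)

lemma exists_eq_three_mul_add_four {n : ℕ} : (∃ j, n = 3 * j + 4) ↔ n % 3 = 1 ∧ 3 ≤ n :=
  ⟨by rintro ⟨j, rfl⟩; omega, fun h => ⟨n / 3 - 1, by omega⟩⟩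

lemma exists_eq_three_mul_add_four_and {n : ℕ} {P : ℕ → Prop} :
    (∃ j, n = 3 * j + 4 ∧ P j) ↔ (n % 3 = 1 ∧ 3 ≤ n) ∧ P (n / 3 - 1) := by
  constructor
  · rintro ⟨j, rfl, h⟩
    refine ⟨by omega, ?_⟩
    rwa [show (3 * j + 4) / 3 - 1 = j by omega]
  · rintro ⟨h, h'⟩
    exact ⟨_, by omega, h'⟩

lemma exists_eq_three_mul_add_three_and {n : ℕ} {P : ℕ → Prop} :
    (∃ j, n = 3 * j + 3 ∧ P j) ↔ (n % 3 = 0 ∧ 3 ≤ n) ∧ P (n / 3 - 1) := by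
  constructor
  · rintro ⟨j, rfl, h⟩
    refine ⟨by omega, ?_⟩
    rwa [show (3 * j + 3) / 3 - 1 = j by omega]
  · rintro ⟨h, h'⟩
    exact ⟨_, by omega, h'⟩

lemma langMem_eq_true (a : Idx) (n : ℕ) : langMem a n = true ↔ n ∈ lang a := by
  rcases a with _ | _ | k | ⟨l, T⟩
  · simp [langMem, lang, exists_eq_three_mul_add_four]
  · simp [langMem, lang]
  · simp only [langMem, columnMem, lang, Set.mem_ofPred_eq, decide_eq_true_eq,
      exists_eq_three_mul_add_four, exists_eq_three_mul_add_three_and]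
  · simp only [langMem, taggedMem, lang, Set.mem_ofPred_eq, decide_eq_true_eq,
      exists_eq_three_mul_add_four_and, exists_eq_three_mul_add_three_and,
      Nat.testBit_eq_decide_div_mod_eq, ne_eq]

lemma primrec_two_pow : Primrec fun n : ℕ => 2 ^ n :=
  (Primrec₂.unpaired'.1 Nat.Primrec.pow).comp (Primrec.const 2) Primrec.id

/-- The residue class tests used by `langMem` are primitive recursive. -/
lemma primrecPred_mod_three (r : ℕ) : PrimrecPred fun n : ℕ => n % 3 = r ∧ 3 ≤ n :=
  (Primrec.eq.comp (Primrec.nat_mod.comp Primrec.id (Primrec.const 3)) (Primrec.const r)).and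
    (Primrec.nat_le.comp (Primrec.const 3) Primrec.id)

lemma primrec_div_three_sub_one : Primrec fun n : ℕ => n / 3 - 1 :=
  Primrec.nat_sub.comp (Primrec.nat_div.comp Primrec.id (Primrec.const 3)) (Primrec.const 1)

lemma primrec_unpair_fst : Primrec fun n : ℕ => n.unpair.1 := Primrec.fst.comp Primrec.unpair

lemma primrecPred_snd_eq {α : Type*} [Primcodable α] (c : ℕ) :
    PrimrecPred fun p : α × ℕ => p.2 = c := Primrec.eq.comp Primrec.snd (Primrec.const c)

lemma primrec_columnMem : Primrec₂ columnMem := by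
  refine PrimrecPred.decide (PrimrecPred.or (primrecPred_snd_eq 0) (PrimrecPred.or
    (primrecPred_snd_eq 1) (PrimrecPred.or ((primrecPred_mod_three 1).comp Primrec.snd)
    (PrimrecPred.and ((primrecPred_mod_three 0).comp Primrec.snd) ?_))))
  exact Primrec.eq.comp (primrec_unpair_fst.comp (primrec_div_three_sub_one.comp Primrec.snd))
    Primrec.fst

lemma primrec_taggedMem : Primrec₂ taggedMem := by
  have hd : Primrec fun p : (ℕ × ℕ) × ℕ => p.2 / 3 - 1 :=
    primrec_div_three_sub_one.comp Primrec.snd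
  refine PrimrecPred.decide (PrimrecPred.or (primrecPred_snd_eq 0) (PrimrecPred.or
    (primrecPred_snd_eq 1) (PrimrecPred.or (primrecPred_snd_eq 2) (PrimrecPred.or ?_
    (PrimrecPred.or (PrimrecPred.and ((primrecPred_mod_three 1).comp Primrec.snd) ?_)
      (PrimrecPred.and ((primrecPred_mod_three 0).comp Primrec.snd) ?_))))))
  · exact Primrec.eq.comp Primrec.snd (Primrec.nat_add.comp (Primrec.nat_mul.comp
      (Primrec.const 3) (Primrec.fst.comp Primrec.fst)) (Primrec.const 5))
  · exact PrimrecPred.not (Primrec.eq.comp hd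
      (primrec_unpair_fst.comp (Primrec.fst.comp Primrec.fst)))
  · exact Primrec.eq.comp (Primrec.nat_mod.comp (Primrec.nat_div.comp
      (Primrec.snd.comp Primrec.fst) (primrec_two_pow.comp hd)) (Primrec.const 2))
      (Primrec.const 1)

lemma primrec_langMem : Primrec₂ langMem := by
  refine Primrec.option_casesOn (o := fun p : Idx × ℕ => p.1)
    (f := fun p : Idx × ℕ => decide (p.2 = 0 ∨ p.2 = 2 ∨ (p.2 % 3 = 1 ∧ 3 ≤ p.2)))
    (g := fun (p : Idx × ℕ) o => Option.casesOn o (decide (p.2 = 1))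
      fun s => Sum.casesOn s (fun k => columnMem k p.2) (fun t => taggedMem t p.2))
    Primrec.fst ?_ ?_
  · exact PrimrecPred.decide (PrimrecPred.or (primrecPred_snd_eq 0)
      (PrimrecPred.or (primrecPred_snd_eq 2) ((primrecPred_mod_three 1).comp Primrec.snd)))
  refine Primrec.option_casesOn
    (o := fun p : (Idx × ℕ) × Option (ℕ ⊕ ℕ × ℕ) => p.2)
    (f := fun p : (Idx × ℕ) × Option (ℕ ⊕ ℕ × ℕ) => decide (p.1.2 = 1))
    (g := fun (p : (Idx × ℕ) × Option (ℕ ⊕ ℕ × ℕ)) s =>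
      Sum.casesOn s (fun k => columnMem k p.1.2) (fun t => taggedMem t p.1.2))
    Primrec.snd ?_ ?_
  · exact PrimrecPred.decide ((primrecPred_snd_eq 1).comp Primrec.fst)
  exact Primrec.sumCasesOn
    (f := fun p : ((Idx × ℕ) × Option (ℕ ⊕ ℕ × ℕ)) × (ℕ ⊕ ℕ × ℕ) => p.2)
    (g := fun (p : ((Idx × ℕ) × Option (ℕ ⊕ ℕ × ℕ)) × (ℕ ⊕ ℕ × ℕ)) k => columnMem k p.1.1.2)
    (h := fun (p : ((Idx × ℕ) × Option (ℕ ⊕ ℕ × ℕ)) × (ℕ ⊕ ℕ × ℕ)) t => taggedMem t p.1.1.2)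
    Primrec.snd
    (primrec_columnMem.comp Primrec.snd
      (Primrec.snd.comp (Primrec.fst.comp (Primrec.fst.comp Primrec.fst))))
    (primrec_taggedMem.comp Primrec.snd
      (Primrec.snd.comp (Primrec.fst.comp (Primrec.fst.comp Primrec.fst))))

lemma isIndexedFamily_langFamily : IsIndexedFamily langFamily := by
  refine ⟨fun i => ?_, fun i n => langMem (Denumerable.ofNat Idx i) n, ?_,
    fun i n => langMem_eq_true _ n⟩
  · unfold langFamily
    rcases Denumerable.ofNat Idx i with _ | _ | k | ⟨l, T⟩
    exacts [⟨0, .inl rfl⟩, ⟨1, rfl⟩, ⟨0, .inl rfl⟩, ⟨0, .inl rfl⟩]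
  · exact (primrec_langMem.comp ((Primrec.ofNat Idx).comp Primrec.fst) Primrec.snd).to_comp

/-- Set the `i`-th bit of `T`. -/
def insertBit (T i : ℕ) : ℕ := if T / 2 ^ i % 2 = 1 then T else T + 2 ^ i

lemma testBit_add_two_pow {T i : ℕ} (h : T.testBit i = false) (j : ℕ) :
    (T + 2 ^ i).testBit j = (T.testBit j || decide (i = j)) := by
  induction i generalizing T j with
  | zero =>
    rw [Nat.testBit_zero] at h
    cases j with
    | zero => simp at h ⊢; omega
    | succ j =>
      have : (T + 2 ^ 0) / 2 = T / 2 := by simp at h ⊢; omega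
      rw [Nat.testBit_succ, this, Nat.testBit_succ]; simp
  | succ i ih =>
    cases j with
    | zero => simp [Nat.pow_succ]
    | succ j =>
      have : (T + 2 ^ (i + 1)) / 2 = T / 2 + 2 ^ i := by rw [Nat.pow_succ]; omega
      rw [Nat.testBit_succ, this, Nat.testBit_succ, ih (by rwa [← Nat.testBit_succ])]
      simp

lemma testBit_insertBit (T i j : ℕ) :
    (insertBit T i).testBit j = (T.testBit j || decide (i = j)) := by
  unfold insertBit
  split_ifs with h
  · by_cases hij : i = j
    · subst hij; simp [Nat.testBit_eq_decide_div_mod_eq, h]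
    · simp [hij]
  · exact testBit_add_two_pow (by simpa [Nat.testBit_eq_decide_div_mod_eq] using h) j

/-- The update of the history bounded engine in the state `none`. -/
def initialStep (v : ℕ) (c : Option ℕ) : Idx :=
  if v = 1 then (if c = some 0 then some none else none)
  else if v % 3 = 0 ∧ 3 ≤ v then
    (if c = some 2 then some (some (Sum.inl (v / 3 - 1).unpair.1))
      else some (some (Sum.inr (0, insertBit 0 (v / 3 - 1)))))
  else if v % 3 = 2 ∧ 3 ≤ v then some (some (Sum.inr (v / 3 - 1, 0)))
  else none

/-- The update of the history bounded engine in a tagged state. -/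
def taggedStep (p : ℕ × ℕ) (v : ℕ) : ℕ × ℕ :=
  if v % 3 = 0 ∧ 3 ≤ v then (p.1, insertBit p.2 (v / 3 - 1))
  else if v % 3 = 2 ∧ 3 ≤ v then (v / 3 - 1, p.2)
  else p

/-- The update function of the history bounded engine. -/
def engineStep (s : Idx) (x c : Option ℕ) : Idx :=
  Option.casesOn x s fun v => Option.casesOn s (initialStep v c) fun o =>
    Option.casesOn o (some none) fun t =>
      Sum.casesOn t (fun k => some (some (Sum.inl k)))
        fun p => some (some (Sum.inr (taggedStep p v)))

/-- The update function of the history bounded engine on natural number indices. -/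
def engine (n : ℕ) (x c : Option ℕ) : ℕ :=
  Encodable.encode (engineStep (Denumerable.ofNat Idx n) x c)

lemma primrec_insertBit : Primrec₂ insertBit := by
  refine Primrec.ite ?_ Primrec.fst
    (Primrec.nat_add.comp Primrec.fst (primrec_two_pow.comp Primrec.snd))
  exact Primrec.eq.comp (Primrec.nat_mod.comp (Primrec.nat_div.comp
      Primrec.fst (primrec_two_pow.comp Primrec.snd)) (Primrec.const 2)) (Primrec.const 1)

lemma primrec_initialStep : Primrec₂ initialStep := by
  have hd : Primrec fun p : ℕ × Option ℕ => p.1 / 3 - 1 :=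
    primrec_div_three_sub_one.comp Primrec.fst
  have hc (m : ℕ) : PrimrecPred fun p : ℕ × Option ℕ => p.2 = some m :=
    Primrec.eq.comp Primrec.snd (Primrec.const (some m))
  refine Primrec.ite (Primrec.eq.comp Primrec.fst (Primrec.const 1))
    (Primrec.ite (hc 0) (Primrec.const _) (Primrec.const _))
    (Primrec.ite ((primrecPred_mod_three 0).comp Primrec.fst)
      (Primrec.ite (hc 2) ?_ ?_)
      (Primrec.ite ((primrecPred_mod_three 2).comp Primrec.fst) ?_ (Primrec.const _)))
  · exact Primrec.option_some.comp (Primrec.option_some.comp (Primrec.sumInl.comp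
      (primrec_unpair_fst.comp hd)))
  · exact Primrec.option_some.comp (Primrec.option_some.comp (Primrec.sumInr.comp
      (Primrec.pair (Primrec.const 0) (primrec_insertBit.comp (Primrec.const 0) hd))))
  · exact Primrec.option_some.comp (Primrec.option_some.comp (Primrec.sumInr.comp
      (Primrec.pair hd (Primrec.const 0))))

lemma primrec_taggedStep : Primrec₂ taggedStep := by
  have hd : Primrec fun p : (ℕ × ℕ) × ℕ => p.2 / 3 - 1 :=
    primrec_div_three_sub_one.comp Primrec.snd
  refine Primrec.ite ((primrecPred_mod_three 0).comp Primrec.snd) ?_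
    (Primrec.ite ((primrecPred_mod_three 2).comp Primrec.snd) ?_ Primrec.fst)
  · exact Primrec.pair (Primrec.fst.comp Primrec.fst)
      (primrec_insertBit.comp (Primrec.snd.comp Primrec.fst) hd)
  · exact Primrec.pair hd (Primrec.snd.comp Primrec.fst)

lemma primrec_engineStep :
    Primrec fun p : Idx × Option ℕ × Option ℕ => engineStep p.1 p.2.1 p.2.2 := by
  refine Primrec.option_casesOn (o := fun p : Idx × Option ℕ × Option ℕ => p.2.1)
    (f := fun p : Idx × Option ℕ × Option ℕ => p.1)
    (g := fun (p : Idx × Option ℕ × Option ℕ) v =>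
      Option.casesOn p.1 (initialStep v p.2.2) fun o =>
        Option.casesOn o (some none) fun t =>
          Sum.casesOn t (fun k => some (some (Sum.inl k)))
            fun q => some (some (Sum.inr (taggedStep q v))))
    (Primrec.fst.comp Primrec.snd) Primrec.fst ?_
  refine Primrec.option_casesOn (o := fun p : (Idx × Option ℕ × Option ℕ) × ℕ => p.1.1)
    (f := fun p : (Idx × Option ℕ × Option ℕ) × ℕ => initialStep p.2 p.1.2.2)
    (g := fun (p : (Idx × Option ℕ × Option ℕ) × ℕ) o =>
        Option.casesOn o (some none) fun t =>
          Sum.casesOn t (fun k => some (some (Sum.inl k)))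
            fun q => some (some (Sum.inr (taggedStep q p.2))))
    (Primrec.fst.comp Primrec.fst)
    (primrec_initialStep.comp Primrec.snd (Primrec.snd.comp (Primrec.snd.comp Primrec.fst))) ?_
  refine Primrec.option_casesOn
    (o := fun p : ((Idx × Option ℕ × Option ℕ) × ℕ) × Option (ℕ ⊕ ℕ × ℕ) => p.2)
    (f := fun _ => (some none : Idx))
    (g := fun (p : ((Idx × Option ℕ × Option ℕ) × ℕ) × Option (ℕ ⊕ ℕ × ℕ)) t =>
          Sum.casesOn t (fun k => some (some (Sum.inl k)))
            fun q => some (some (Sum.inr (taggedStep q p.1.2))))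
    Primrec.snd (Primrec.const _) ?_
  refine Primrec.sumCasesOn
    (f := fun p : (((Idx × Option ℕ × Option ℕ) × ℕ) × Option (ℕ ⊕ ℕ × ℕ)) × (ℕ ⊕ ℕ × ℕ) => p.2)
    (g := fun _ k => (some (some (Sum.inl k)) : Idx))
    (h := fun (p : (((Idx × Option ℕ × Option ℕ) × ℕ) × Option (ℕ ⊕ ℕ × ℕ)) × (ℕ ⊕ ℕ × ℕ)) q =>
      (some (some (Sum.inr (taggedStep q p.1.1.2))) : Idx))
    Primrec.snd
    (Primrec.option_some.comp (Primrec.option_some.comp (Primrec.sumInl.comp Primrec.snd)))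
    (Primrec.option_some.comp (Primrec.option_some.comp (Primrec.sumInr.comp
      (primrec_taggedStep.comp Primrec.snd
        (Primrec.snd.comp (Primrec.fst.comp (Primrec.fst.comp Primrec.fst)))))))

lemma engineComputable_engine : EngineComputable engine :=
  (Primrec.encode.comp (primrec_engineStep.comp
    (Primrec.pair ((Primrec.ofNat Idx).comp Primrec.fst) Primrec.snd))).to_comp

lemma initialStep_one (c : Option ℕ) :
    initialStep 1 c = if c = some 0 then some none else none := rfl

lemma initialStep_value (i : ℕ) (c : Option ℕ) :
    initialStep (3 * i + 3) c = if c = some 2 then some (some (Sum.inl i.unpair.1))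
      else some (some (Sum.inr (0, insertBit 0 i))) := by
  have h2 : (3 * i + 3) % 3 = 0 := by omega
  simp [initialStep, h2]

lemma initialStep_tag (l : ℕ) (c : Option ℕ) :
    initialStep (3 * l + 5) c = some (some (Sum.inr (l, 0))) := by
  have h1 : (3 * l + 5) / 3 - 1 = l := by omega
  have h2 : (3 * l + 5) % 3 = 2 := by omega
  have h3 : 3 ≤ 3 * l + 5 := by omega
  simp [initialStep, h1, h2, h3]

lemma initialStep_other {v : ℕ} (c : Option ℕ) (h : v = 0 ∨ v = 2 ∨ ∃ j, v = 3 * j + 4) :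
    initialStep v c = none := by
  have h1 : v ≠ 1 := by rcases h with h | h | ⟨j, h⟩ <;> omega
  have h2 : ¬ (v % 3 = 0 ∧ 3 ≤ v) := by rcases h with h | h | ⟨j, h⟩ <;> omega
  have h3 : ¬ (v % 3 = 2 ∧ 3 ≤ v) := by rcases h with h | h | ⟨j, h⟩ <;> omega
  simp only [initialStep, h1, h2, h3, if_false]

lemma taggedStep_value (p : ℕ × ℕ) (i : ℕ) :
    taggedStep p (3 * i + 3) = (p.1, insertBit p.2 i) := by
  have h2 : (3 * i + 3) % 3 = 0 := by omega
  simp [taggedStep, h2]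

lemma taggedStep_tag (p : ℕ × ℕ) (l : ℕ) : taggedStep p (3 * l + 5) = (l, p.2) := by
  have h1 : (3 * l + 5) / 3 - 1 = l := by omega
  have h2 : (3 * l + 5) % 3 = 2 := by omega
  have h3 : 3 ≤ 3 * l + 5 := by omega
  simp [taggedStep, h1, h2, h3]

lemma taggedStep_other (p : ℕ × ℕ) {v : ℕ} (h : v ≤ 2 ∨ ∃ j, v = 3 * j + 4) :
    taggedStep p v = p := by
  have h2 : ¬ (v % 3 = 0 ∧ 3 ≤ v) := by rcases h with h | ⟨j, h⟩ <;> omega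
  have h3 : ¬ (v % 3 = 2 ∧ 3 ≤ v) := by rcases h with h | ⟨j, h⟩ <;> omega
  simp only [taggedStep, h2, h3, if_false]

/-- The answer `c` in round `n` of the trace `τ` is an admissible history bounded counterexample
to the candidate `K` for the target `L`. -/
def HistoryAdmissible (L K : Set ℕ) (τ : ℕ → Option ℕ) (n : ℕ) (c : Option ℕ) : Prop :=
  ((∃ m, m ∈ K \ L ∧ ∃ j ≤ n, ∃ v, τ j = some v ∧ m < v) →
      ∃ m, c = some m ∧ m ∈ K \ L ∧ ∃ j ≤ n, ∃ v, τ j = some v ∧ m < v) ∧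
    ((¬ ∃ m, m ∈ K \ L ∧ ∃ j ≤ n, ∃ v, τ j = some v ∧ m < v) → c = none)

lemma HistoryAdmissible.mem {L K : Set ℕ} {τ : ℕ → Option ℕ} {n m : ℕ} {c : Option ℕ}
    (h : HistoryAdmissible L K τ n c) (hc : c = some m) : m ∈ K \ L := by
  by_cases hex : ∃ m, m ∈ K \ L ∧ ∃ j ≤ n, ∃ v, τ j = some v ∧ m < v
  · obtain ⟨m', h1, h2, -⟩ := h.1 hex
    rw [hc] at h1
    cases h1
    exact h2
  · simp [h.2 hex] at hc

lemma HistoryAdmissible.exists_lt {L K : Set ℕ} {τ : ℕ → Option ℕ} {n m v : ℕ} {c : Option ℕ}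
    (h : HistoryAdmissible L K τ n c) (hm : m ∈ K \ L) (hv : τ n = some v) (hmv : m < v) :
    ∃ m', c = some m' ∧ m' ∈ K \ L ∧ ∃ j ≤ n, ∃ v, τ j = some v ∧ m' < v :=
  h.1 ⟨m, hm, n, le_rfl, v, hv, hmv⟩

section Engine

variable {a : Idx} {τ cex : ℕ → Option ℕ} {p : ℕ → Idx}

lemma engine_converges_initial (hτ : IsTrace τ (lang none)) (h0 : p 0 = none)
    (hs : ∀ n, p (n + 1) = engineStep (p n) (τ n) (cex n)) (n : ℕ) : p n = none := by
  induction n with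
  | zero => exact h0
  | succ n ih =>
    rw [hs, ih]
    cases hx : τ n with
    | none => rfl
    | some v => exact initialStep_other _ (hτ.subset ⟨n, hx⟩)

lemma engine_converges_singleton (hτ : IsTrace τ (lang (some none))) (h0 : p 0 = none)
    (hs : ∀ n, p (n + 1) = engineStep (p n) (τ n) (cex n))
    (hc : ∀ n, HistoryAdmissible (lang (some none)) (lang (p n)) τ n (cex n)) :
    ∃ N, ∀ n ≥ N, p n = some none := by
  have hval : ∀ n v, τ n = some v → v = 1 := fun n v h => hτ.subset ⟨n, h⟩
  have hinv : ∀ n, p n = none ∨ p n = some none := by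
    intro n
    induction n with
    | zero => exact .inl h0
    | succ n ih =>
      rw [hs]
      rcases ih with ih | ih <;> rw [ih]
      · cases hx : τ n with
        | none => exact .inl rfl
        | some v =>
          rw [hval n v hx]
          change initialStep 1 _ = _ ∨ initialStep 1 _ = _
          rw [initialStep_one]
          split_ifs <;> simp
      · cases τ n <;> exact .inr rfl
  obtain ⟨N, hN⟩ : ∃ n, τ n = some 1 := hτ.superset rfl
  refine ⟨N + 1, fun n hn => ?_⟩
  induction n, hn using Nat.le_induction with
  | base =>
    rw [hs, hN]
    rcases hinv N with h | h
    · have hcN := hc N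
      rw [h] at hcN ⊢
      obtain ⟨m, hm, -, j, -, v, hv, hlt⟩ :=
        hcN.exists_lt (m := 0) (v := 1) ⟨.inl rfl, by simp [lang]⟩ hN one_pos
      obtain rfl : m = 0 := by have := hval _ _ hv; omega
      change initialStep 1 _ = _
      rw [initialStep_one, if_pos hm]
    · rw [h]; rfl
  | succ n _ ih => rw [hs, ih]; cases τ n <;> rfl

lemma engine_converges_column {k : ℕ} (hτ : IsTrace τ (lang (some (some (Sum.inl k)))))
    (h0 : p 0 = none) (hs : ∀ n, p (n + 1) = engineStep (p n) (τ n) (cex n))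
    (hc : ∀ n, HistoryAdmissible (lang (some (some (Sum.inl k)))) (lang (p n)) τ n (cex n)) :
    ∃ N, ∀ n ≥ N, p n = some (some (Sum.inl k)) := by
  have hval : ∀ n v, τ n = some v → v ∈ lang (some (some (Sum.inl k))) :=
    fun n v h => hτ.subset ⟨n, h⟩
  have hdiff : ∀ m, m ∈ lang none \ lang (some (some (Sum.inl k))) → m = 2 := by
    rintro m ⟨h | h | h, hm⟩
    · exact absurd (.inl h) hm
    · exact h
    · exact absurd (.inr (.inr (.inl h))) hm
  have hvalue : ∀ n i, p n = none → τ n = some (3 * i + 3) →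
      p (n + 1) = some (some (Sum.inl k)) := by
    intro n i hp hx
    have hik : i.unpair.1 = k := by
      rcases hval _ _ hx with h | h | ⟨j, h⟩ | ⟨j, h, hj⟩
      · omega
      · omega
      · omega
      · obtain rfl : i = j := by omega
        exact hj
    have hcn := hc n
    rw [hp] at hcn
    obtain ⟨m, hm, hmem, -⟩ := hcn.exists_lt (m := 2) ⟨.inr (.inl rfl), by
      rintro (h | h | ⟨j, h⟩ | ⟨j, h, -⟩) <;> omega⟩ hx (by omega)
    obtain rfl := hdiff m hmem
    rw [hs, hp, hx]
    change initialStep _ _ = _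
    rw [initialStep_value, if_pos hm, hik]
  have hinv : ∀ n, p n = none ∨ p n = some (some (Sum.inl k)) := by
    intro n
    induction n with
    | zero => exact .inl h0
    | succ n ih =>
      rcases ih with ih | ih
      · cases hx : τ n with
        | none => left; rw [hs, ih, hx]; rfl
        | some v =>
          have hcn := hc n
          rw [ih] at hcn
          rcases hval n v hx with rfl | rfl | h | ⟨i, rfl, hi⟩
          · left; rw [hs, ih, hx]; exact initialStep_other _ (.inl rfl)
          · left
            rw [hs, ih, hx]
            change initialStep 1 _ = _
            rw [initialStep_one, if_neg]
            intro h0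
            exact absurd (hdiff _ (hcn.mem h0)) (by omega)
          · left; rw [hs, ih, hx]; exact initialStep_other _ (.inr (.inr h))
          · exact .inr (hvalue n i ih hx)
      · right; rw [hs, ih]; cases τ n <;> rfl
  obtain ⟨N, hN⟩ : ∃ n, τ n = some (3 * Nat.pair k 0 + 3) :=
    hτ.superset (.inr (.inr (.inr ⟨_, rfl, by simp⟩)))
  refine ⟨N + 1, fun n hn => ?_⟩
  induction n, hn using Nat.le_induction with
  | base =>
    rcases hinv N with h | h
    · exact hvalue N _ h hN
    · rw [hs, h, hN]; rfl
  | succ n _ ih => rw [hs, ih]; cases τ n <;> rfl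

/-- The invariant of the history bounded engine on a target with tag `l`. -/
def TaggedInvariant (l : ℕ) (τ : ℕ → Option ℕ) (n : ℕ) (s : Idx) : Prop :=
  (s = none ∧ ∀ m < n, ∀ i, τ m ≠ some (3 * i + 3) ∧ τ m ≠ some (3 * i + 5)) ∨
    ∃ l' T', s = some (some (Sum.inr (l', T'))) ∧
      (∀ i, T'.testBit i = true ↔ ∃ m < n, τ m = some (3 * i + 3)) ∧
      ((∃ m < n, τ m = some (3 * l + 5)) → l' = l)

lemma exists_forall_lt_exists_lt {P : ℕ → ℕ → Prop} (K : ℕ) (h : ∀ i < K, ∃ n, P i n) :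
    ∃ N, ∀ i < K, ∃ n < N, P i n := by
  choose! f hf using h
  exact ⟨(Finset.range K).sup f + 1, fun i hi => ⟨f i,
    Nat.lt_succ_of_le (Finset.le_sup (f := f) (Finset.mem_range.2 hi)), hf i hi⟩⟩

lemma TaggedInvariant.step {l T n : ℕ} {s : Idx} {c : Option ℕ}
    (hx : ∀ v, τ n = some v → v ∈ lang (some (some (Sum.inr (l, T)))))
    (hc : HistoryAdmissible (lang (some (some (Sum.inr (l, T))))) (lang s) τ n c)
    (h : TaggedInvariant l τ n s) : TaggedInvariant l τ (n + 1) (engineStep s (τ n) c) := by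
  have hlt : ∀ w, (∃ m < n + 1, τ m = some w) ↔ (∃ m < n, τ m = some w) ∨ τ n = some w := by
    intro w
    constructor
    · rintro ⟨m, hm, e⟩
      rcases Nat.lt_succ_iff_lt_or_eq.1 hm with hm | rfl
      exacts [.inl ⟨m, hm, e⟩, .inr e]
    · rintro (⟨m, hm, h⟩ | h)
      exacts [⟨m, by omega, h⟩, ⟨n, by omega, h⟩]
  rcases h with ⟨rfl, h⟩ | ⟨l', T', rfl, hT, hl⟩
  · have hnone : ∀ i, ¬ (∃ m < n, τ m = some (3 * i + 3)) := fun i ⟨m, hm, e⟩ => (h m hm i).1 e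
    have hnone' : ∀ i, ¬ (∃ m < n, τ m = some (3 * i + 5)) := fun i ⟨m, hm, e⟩ => (h m hm i).2 e
    have hstay : (∀ i, τ n ≠ some (3 * i + 3) ∧ τ n ≠ some (3 * i + 5)) →
        TaggedInvariant l τ (n + 1) none := by
      refine fun hn => .inl ⟨rfl, fun m hm i => ?_⟩
      rcases Nat.lt_succ_iff_lt_or_eq.1 hm with hm | rfl
      exacts [h m hm i, hn i]
    have hc0 : c ≠ some 0 := fun e => (hc.mem e).2 (.inl rfl)
    have hc2 : c ≠ some 2 := fun e => (hc.mem e).2 (.inr (.inr (.inl rfl)))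
    cases hv : τ n with
    | none => exact hstay (by simp [hv])
    | some v =>
      change TaggedInvariant l τ (n + 1) (initialStep v c)
      have hother : (v = 0 ∨ v = 2 ∨ ∃ j, v = 3 * j + 4) →
          TaggedInvariant l τ (n + 1) (initialStep v c) := by
        intro hv'
        rw [initialStep_other c hv']
        refine hstay fun i => ?_
        simp only [hv, ne_eq, Option.some.injEq]
        rcases hv' with h | h | ⟨j, h⟩ <;> omega
      rcases hx v hv with h | rfl | h | rfl | ⟨j, h, -⟩ | ⟨i, rfl, -⟩
      · exact hother (.inl h)
      · rw [initialStep_one, if_neg hc0]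
        refine hstay fun i => ?_
        simp only [hv, ne_eq, Option.some.injEq]
        omega
      · exact hother (.inr (.inl h))
      · rw [initialStep_tag]
        refine .inr ⟨_, _, rfl, fun i => ?_, fun _ => rfl⟩
        simp only [hlt, hnone, hv, Nat.zero_testBit, Option.some.injEq, false_or]
        simp only [Bool.false_eq_true, false_iff]
        omega
      · exact hother (.inr (.inr ⟨j, h⟩))
      · rw [initialStep_value, if_neg hc2]
        refine .inr ⟨_, _, rfl, fun j => ?_, ?_⟩
        · simp only [hlt, hnone, hv, testBit_insertBit, Nat.zero_testBit, Option.some.injEq,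
            false_or, Bool.false_or, decide_eq_true_eq]
          omega
        · simp only [hlt, hnone', hv, Option.some.injEq, false_or]
          omega
  · cases hv : τ n with
    | none =>
      refine .inr ⟨_, _, rfl, fun i => ?_, ?_⟩
      · simp only [hlt, hT, hv, reduceCtorEq, or_false]
      · simpa only [hlt, hv, reduceCtorEq, or_false] using hl
    | some v =>
      change TaggedInvariant l τ (n + 1) (some (some (Sum.inr (taggedStep (l', T') v))))
      have hother : (v ≤ 2 ∨ ∃ j, v = 3 * j + 4) →
          TaggedInvariant l τ (n + 1) (some (some (Sum.inr (taggedStep (l', T') v)))) := by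
        intro hv'
        rw [taggedStep_other _ hv']
        refine .inr ⟨_, _, rfl, fun i => ?_, ?_⟩
        · have : v ≠ 3 * i + 3 := by rcases hv' with h | ⟨j, h⟩ <;> omega
          simp only [hlt, hT, hv, Option.some.injEq, this, or_false]
        · have : v ≠ 3 * l + 5 := by rcases hv' with h | ⟨j, h⟩ <;> omega
          simpa only [hlt, hv, Option.some.injEq, this, or_false] using hl
      rcases hx v hv with h | h | h | rfl | ⟨j, h, -⟩ | ⟨i, rfl, -⟩
      · exact hother (.inl (by omega))
      · exact hother (.inl (by omega))
      · exact hother (.inl (by omega))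
      · rw [taggedStep_tag]
        refine .inr ⟨_, _, rfl, fun i => ?_, fun _ => rfl⟩
        have : 3 * l + 5 ≠ 3 * i + 3 := by omega
        simp only [hlt, hT, hv, Option.some.injEq, this, or_false]
      · exact hother (.inr ⟨j, h⟩)
      · rw [taggedStep_value]
        refine .inr ⟨_, _, rfl, fun j => ?_, ?_⟩
        · simp only [hlt, hv, testBit_insertBit, Option.some.injEq, Bool.or_eq_true, hT,
            decide_eq_true_eq]
          have : i = j ↔ 3 * i + 3 = 3 * j + 3 := by omega
          rw [this]
        · have : 3 * i + 3 ≠ 3 * l + 5 := by omega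
          simpa only [hlt, hv, Option.some.injEq, this, or_false] using hl

lemma engine_converges_tagged {l T : ℕ} (hτ : IsTrace τ (lang (some (some (Sum.inr (l, T))))))
    (h0 : p 0 = none) (hs : ∀ n, p (n + 1) = engineStep (p n) (τ n) (cex n))
    (hc : ∀ n, HistoryAdmissible (lang (some (some (Sum.inr (l, T))))) (lang (p n)) τ n (cex n)) :
    ∃ N, ∀ n ≥ N, p n = some (some (Sum.inr (l, T))) := by
  have hval : ∀ n v, τ n = some v → v ∈ lang (some (some (Sum.inr (l, T)))) :=
    fun n v h => hτ.subset ⟨n, h⟩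
  have hinv : ∀ n, TaggedInvariant l τ n (p n) := by
    intro n
    induction n with
    | zero => exact .inl ⟨h0, by simp⟩
    | succ n ih => rw [hs]; exact ih.step (hval n) (hc n)
  obtain ⟨M, hM⟩ : ∃ n, τ n = some (3 * l + 5) := hτ.superset (.inr (.inr (.inr (.inl rfl))))
  obtain ⟨N, hN⟩ := exists_forall_lt_exists_lt
    (P := fun i n => T.testBit i = true → τ n = some (3 * i + 3)) T fun i _ => by
      by_cases hi : T.testBit i = true
      · obtain ⟨n, hn⟩ : ∃ n, τ n = some (3 * i + 3) :=
          hτ.superset (.inr (.inr (.inr (.inr (.inr ⟨i, rfl, hi⟩)))))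
        exact ⟨n, fun _ => hn⟩
      · exact ⟨0, fun h => absurd h hi⟩
  refine ⟨max (M + 1) N, fun n hn => ?_⟩
  rw [ge_iff_le, max_le_iff] at hn
  rcases hinv n with ⟨-, h⟩ | ⟨l', T', h, hT, hl⟩
  · exact absurd hM (h M hn.1 l).2
  · rw [h, hl ⟨M, hn.1, hM⟩]
    congr 4
    refine Nat.eq_of_testBit_eq fun i => Bool.eq_iff_iff.2 ((hT i).trans ⟨?_, fun hi => ?_⟩)
    · rintro ⟨m, -, hm⟩
      rcases hval _ _ hm with h | h | h | h | ⟨j, h, -⟩ | ⟨j, h, hj⟩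
      · omega
      · omega
      · omega
      · omega
      · omega
      · obtain rfl : i = j := by omega
        exact hj
    · obtain ⟨m, hm, hm'⟩ := hN i (lt_of_lt_of_le Nat.lt_two_pow_self (Nat.ge_two_pow_of_testBit hi))
      exact ⟨m, by omega, hm' hi⟩

end Engine

lemma inHCEGIS_langFamily : InHCEGIS langFamily := by
  refine ⟨engine, Encodable.encode (none : Idx), engineComputable_engine, fun i τ hτ cex hc => ?_⟩
  set p : ℕ → Idx := fun n =>
    Denumerable.ofNat Idx (cand engine (Encodable.encode (none : Idx)) τ cex n) with hp
  have h0 : p 0 = none := Denumerable.ofNat_encode _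
  have hs : ∀ n, p (n + 1) = engineStep (p n) (τ n) (cex n) := fun n =>
    Denumerable.ofNat_encode _
  have key : ∃ N, ∀ n ≥ N, p n = Denumerable.ofNat Idx i := by
    unfold langFamily at hτ hc
    generalize Denumerable.ofNat Idx i = a at hτ hc
    rcases a with _ | _ | k | ⟨l, T⟩
    · exact ⟨0, fun n _ => engine_converges_initial hτ h0 hs n⟩
    · exact engine_converges_singleton hτ h0 hs hc
    · exact engine_converges_column hτ h0 hs hc
    · exact engine_converges_tagged hτ h0 hs hc
  obtain ⟨N, hN⟩ := key
  refine ⟨N, i, rfl, fun n hn => ?_⟩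
  simpa [hp] using congrArg Encodable.encode (hN n hn)

lemma lang_injective : Function.Injective lang := by
  intro a b hab
  have hmem : ∀ n, n ∈ lang a ↔ n ∈ lang b := fun n => by rw [hab]
  have h0 := hmem 0
  have h1 := hmem 1
  have h2 := hmem 2
  rcases a with _ | _ | k | ⟨l, T⟩ <;> rcases b with _ | _ | k' | ⟨l', T'⟩
  all_goals try rfl
  all_goals try (exfalso; simp [lang] at h0 h1 h2; done)
  · have h := (hmem (3 * Nat.pair k 0 + 3)).1 (.inr (.inr (.inr ⟨_, rfl, by simp⟩)))
    rcases h with h | h | ⟨j, h⟩ | ⟨j, h, hj⟩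
    · omega
    · omega
    · omega
    · obtain rfl : Nat.pair k 0 = j := by omega
      simp only [Nat.unpair_pair] at hj
      rw [hj]
  · obtain rfl : l = l' := by
      rcases (hmem (3 * l + 5)).1 (.inr (.inr (.inr (.inl rfl)))) with
        h | h | h | h | ⟨j, h, -⟩ | ⟨j, h, -⟩ <;> omega
    have hbit : ∀ U : ℕ, ∀ i, U.testBit i = true ↔
        3 * i + 3 ∈ lang (some (some (Sum.inr (l, U)))) := by
      refine fun U i => ⟨fun h => .inr (.inr (.inr (.inr (.inr ⟨i, rfl, h⟩)))), ?_⟩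
      rintro (h | h | h | h | ⟨j, h, -⟩ | ⟨j, h, hj⟩)
      · omega
      · omega
      · omega
      · omega
      · omega
      · obtain rfl : i = j := by omega
        exact hj
    congr 4
    exact Nat.eq_of_testBit_eq fun i =>
      Bool.eq_iff_iff.2 ((hbit T i).trans ((hmem _).trans (hbit T' i).symm))

/-- The answer `c` is an admissible counterexample to the candidate `K` for the target `L`. -/
def Admissible (L K : Set ℕ) (c : Option ℕ) : Prop :=
  (K ⊆ L → c = none) ∧ (¬ K ⊆ L → ∃ m, c = some m ∧ m ∈ K \ L)

lemma Admissible.of_mem {L K : Set ℕ} {m : ℕ} (hK : m ∈ K) (hL : m ∉ L) :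
    Admissible L K (some m) :=
  ⟨fun h => absurd (h hK) hL, fun _ => ⟨m, rfl, hK, hL⟩⟩

lemma Admissible.of_subset {L K : Set ℕ} (h : K ⊆ L) : Admissible L K none :=
  ⟨fun _ => rfl, fun h' => absurd h h'⟩

lemma exists_admissible (L K : Set ℕ) : ∃ c, Admissible L K c := by
  by_cases h : K ⊆ L
  · exact ⟨none, .of_subset h⟩
  · obtain ⟨m, hK, hL⟩ := Set.not_subset.1 h
    exact ⟨some m, .of_mem hK hL⟩

/-- An update function on `Idx` that identifies every language `lang a` from arbitrary
counterexamples. -/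
def Identifies (G : Idx → Option ℕ → Option ℕ → Idx) (s₀ : Idx) : Prop :=
  ∀ (a : Idx) (xs cs : ℕ → Option ℕ) (w : ℕ → Idx), w 0 = s₀ →
    (∀ n, w (n + 1) = G (w n) (xs n) (cs n)) → IsTrace xs (lang a) →
    (∀ n, Admissible (lang a) (lang (w n)) (cs n)) → ∃ N, ∀ n ≥ N, w n = a

lemma identifies_of_cegisIdentifies {F : ℕ → Option ℕ → Option ℕ → ℕ} {p₀ : ℕ}
    (h : ∀ i, CEGISIdentifies F p₀ langFamily (langFamily i)) :
    Identifies (fun s x c => Denumerable.ofNat Idx (F (Encodable.encode s) x c))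
      (Denumerable.ofNat Idx p₀) := by
  intro a xs cs w h0 hs hτ hc
  have hw : ∀ n, cand F p₀ xs cs n = Encodable.encode (w n) := by
    intro n
    induction n with
    | zero => rw [h0, Denumerable.encode_ofNat]; rfl
    | succ n ih => rw [hs, Denumerable.encode_ofNat, ← ih]; rfl
  have ha : langFamily (Encodable.encode a) = lang a := by
    rw [langFamily, Denumerable.ofNat_encode]
  obtain ⟨N, j, hj, hN⟩ := h (Encodable.encode a) xs (by rwa [ha]) cs fun n => by
    rw [hw, ha, langFamily, Denumerable.ofNat_encode]
    exact hc n
  refine ⟨N, fun n hn => lang_injective ?_⟩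
  rw [← ha, ← hj, ← hN n hn, hw, langFamily, Denumerable.ofNat_encode]

section Game

variable {G : Idx → Option ℕ → Option ℕ → Idx} {s₀ : Idx}

/-- The state reached from `s` after a history, latest round first. -/
def run (G : Idx → Option ℕ → Option ℕ → Idx) (s : Idx) : List (Option ℕ × Option ℕ) → Idx
  | [] => s
  | u :: h => G (run G s h) u.1 u.2

/-- The history is a legal beginning of the game from `s` with target `L`. -/
def Legal (G : Idx → Option ℕ → Option ℕ → Idx) (s : Idx) (L : Set ℕ) :
    List (Option ℕ × Option ℕ) → Prop
  | [] => True
  | u :: h => Legal G s L h ∧ (∀ v, u.1 = some v → v ∈ L) ∧ Admissible L (lang (run G s h)) u.2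

lemma run_append (h h' : List (Option ℕ × Option ℕ)) (s : Idx) :
    run G s (h' ++ h) = run G (run G s h) h' := by
  induction h' with
  | nil => rfl
  | cons u h' ih => simp only [List.cons_append, run, ih]

lemma Legal.append {h h' : List (Option ℕ × Option ℕ)} {s : Idx} {L : Set ℕ}
    (hh : Legal G s L h) (hh' : Legal G (run G s h) L h') : Legal G s L (h' ++ h) := by
  induction h' with
  | nil => exact hh
  | cons u h' ih =>
    refine ⟨ih hh'.1, hh'.2.1, ?_⟩
    change Admissible L (lang (run G s (h' ++ h))) u.2
    rw [run_append]
    exact hh'.2.2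

lemma Identifies.converges_after (hid : Identifies G s₀) {a : Idx}
    {h : List (Option ℕ × Option ℕ)} (hh : Legal G s₀ (lang a) h) {xs cs : ℕ → Option ℕ}
    {w : ℕ → Idx} (h0 : w 0 = run G s₀ h) (hs : ∀ n, w (n + 1) = G (w n) (xs n) (cs n))
    (hmem : ∀ n v, xs n = some v → v ∈ lang a)
    (hall : ∀ v ∈ lang a, (∃ u ∈ h, u.1 = some v) ∨ ∃ n, xs n = some v)
    (hc : ∀ n, Admissible (lang a) (lang (w n)) (cs n)) : ∃ N, ∀ n ≥ N, w n = a := by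
  induction h generalizing xs cs w with
  | nil =>
    refine hid a xs cs w h0 hs (Set.ext fun v => ⟨fun ⟨n, hn⟩ => hmem n v hn, fun hv => ?_⟩) hc
    simpa using hall v hv
  | cons u h ih =>
    obtain ⟨N, hN⟩ := ih hh.1 (xs := fun n => Nat.casesOn n u.1 xs)
      (cs := fun n => Nat.casesOn n u.2 cs) (w := fun n => Nat.casesOn n (run G s₀ h) w) rfl
      (by rintro (_ | n); exacts [h0, hs n])
      (by rintro (_ | n); exacts [hh.2.1, hmem n])
      (by
        intro v hv
        rcases hall v hv with ⟨u', hu', hv'⟩ | ⟨n, hn⟩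
        · rcases List.mem_cons.1 hu' with rfl | hu'
          · exact .inr ⟨0, hv'⟩
          · exact .inl ⟨u', hu', hv'⟩
        · exact .inr ⟨n + 1, hn⟩)
      (by rintro (_ | n); exacts [hh.2.2, hc n])
    exact ⟨N, fun n hn => hN (n + 1) (by omega)⟩

/-- The state reached from `s` on the given inputs, latest first, when the counterexample is a
function `c` of the state. -/
def policyRun (G : Idx → Option ℕ → Option ℕ → Idx) (c : Idx → Option ℕ) (s : Idx) :
    List (Option ℕ) → Idx
  | [] => s
  | x :: σ => G (policyRun G c s σ) x (c (policyRun G c s σ))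

/-- The history belonging to `policyRun`. -/
def policyHistory (G : Idx → Option ℕ → Option ℕ → Idx) (c : Idx → Option ℕ) (s : Idx) :
    List (Option ℕ) → List (Option ℕ × Option ℕ)
  | [] => []
  | x :: σ => (x, c (policyRun G c s σ)) :: policyHistory G c s σ

/-- The predicate `P` holds for every pair of a state and the following input. -/
def Along (G : Idx → Option ℕ → Option ℕ → Idx) (c : Idx → Option ℕ) (s : Idx)
    (P : Idx → Option ℕ → Prop) : List (Option ℕ) → Prop
  | [] => True
  | x :: σ => Along G c s P σ ∧ P (policyRun G c s σ) x

/-- The first `n` values of a sequence, latest first. -/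
def latestFirst (xs : ℕ → Option ℕ) : ℕ → List (Option ℕ)
  | 0 => []
  | n + 1 => xs n :: latestFirst xs n

variable {c : Idx → Option ℕ} {s : Idx} {P Q : Idx → Option ℕ → Prop} {σ : List (Option ℕ)}

lemma run_policyHistory : run G s (policyHistory G c s σ) = policyRun G c s σ := by
  induction σ with
  | nil => rfl
  | cons x σ ih => simp only [policyHistory, run, ih, policyRun]

lemma exists_mem_policyHistory {x : Option ℕ} (hx : x ∈ σ) :
    ∃ u ∈ policyHistory G c s σ, u.1 = x := by
  induction σ with
  | nil => simp at hx
  | cons y σ ih =>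
    rcases List.mem_cons.1 hx with rfl | hx
    · exact ⟨_, List.mem_cons_self, rfl⟩
    · obtain ⟨u, hu, hux⟩ := ih hx
      exact ⟨u, List.mem_cons_of_mem _ hu, hux⟩

lemma Along.imp (hPQ : ∀ s x, P s x → Q s x) (h : Along G c s P σ) : Along G c s Q σ := by
  induction σ with
  | nil => trivial
  | cons x σ ih => exact ⟨ih h.1, hPQ _ _ h.2⟩

lemma Along.and (hP : Along G c s P σ) (hQ : Along G c s Q σ) :
    Along G c s (fun s x => P s x ∧ Q s x) σ := by
  induction σ with
  | nil => trivial
  | cons x σ ih => exact ⟨ih hP.1 hQ.1, hP.2, hQ.2⟩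

lemma along_latestFirst {xs : ℕ → Option ℕ} {N : ℕ} :
    Along G c s P (latestFirst xs N) ↔
      ∀ n < N, P (policyRun G c s (latestFirst xs n)) (xs n) := by
  induction N with
  | zero => simp [latestFirst, Along]
  | succ N ih =>
    rw [latestFirst, Along, ih]
    refine ⟨fun h n hn => ?_, fun h => ⟨fun n hn => h n (by omega), h N (by omega)⟩⟩
    rcases Nat.lt_succ_iff_lt_or_eq.1 hn with hn | rfl
    exacts [h.1 n hn, h.2]

lemma Along.legal {L : Set ℕ}
    (h : Along G c s (fun s x => (∀ v, x = some v → v ∈ L) ∧ Admissible L (lang s) (c s)) σ) :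
    Legal G s L (policyHistory G c s σ) := by
  induction σ with
  | nil => trivial
  | cons x σ ih =>
    refine ⟨ih h.1, h.2.1, ?_⟩
    rw [run_policyHistory]
    exact h.2.2

lemma exists_along_ne_column (σ : List (Option ℕ)) :
    ∃ B : Finset ℕ, ∀ k ∉ B, Along G c s (fun s _ => s ≠ some (some (Sum.inl k))) σ := by
  induction σ with
  | nil => exact ⟨∅, fun _ _ => trivial⟩
  | cons x σ ih =>
    obtain ⟨B, hB⟩ := ih
    by_cases h : ∃ k, policyRun G c s σ = some (some (Sum.inl k))
    · obtain ⟨k, hk⟩ := h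
      refine ⟨insert k B, fun k' hk' => ?_⟩
      rw [Finset.mem_insert, not_or] at hk'
      exact ⟨hB k' hk'.2, by rw [hk]; simpa using Ne.symm hk'.1⟩
    · exact ⟨B, fun k hk => ⟨hB k hk, fun e => h ⟨k, e⟩⟩⟩

lemma exists_along_ne_tag (σ : List (Option ℕ)) :
    ∃ B : Finset ℕ, ∀ l ∉ B, Along G c s (fun s _ => ∀ T, s ≠ some (some (Sum.inr (l, T)))) σ := by
  induction σ with
  | nil => exact ⟨∅, fun _ _ => trivial⟩
  | cons x σ ih =>
    obtain ⟨B, hB⟩ := ih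
    by_cases h : ∃ l T, policyRun G c s σ = some (some (Sum.inr (l, T)))
    · obtain ⟨l, T, hl⟩ := h
      refine ⟨insert l B, fun l' hl' => ?_⟩
      rw [Finset.mem_insert, not_or] at hl'
      refine ⟨hB l' hl'.2, fun T' => ?_⟩
      rw [hl]
      simpa using fun h => absurd h.symm hl'.1
    · exact ⟨B, fun l hl => ⟨hB l hl, fun T e => h ⟨l, T, e⟩⟩⟩

lemma exists_forall_mem_lt (σ : List (Option ℕ)) : ∃ M, ∀ v, some v ∈ σ → v < M := by
  induction σ with
  | nil => exact ⟨0, by simp⟩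
  | cons x σ ih =>
    obtain ⟨M, hM⟩ := ih
    refine ⟨max M (x.getD 0 + 1), fun v hv => ?_⟩
    rcases List.mem_cons.1 hv with rfl | hv
    · simp
    · exact lt_max_of_lt_left (hM v hv)

lemma Along.of_mem (h : ∀ x ∈ σ, ∀ s, P s x) : Along G c s P σ := by
  induction σ with
  | nil => trivial
  | cons x σ ih =>
    exact ⟨ih fun y hy => h y (List.mem_cons_of_mem _ hy), h x List.mem_cons_self _⟩

/-- A counterexample policy for the targets `lang (some none)` and
`lang (some (some (Sum.inl k)))`. -/
def columnPolicy : Idx → Option ℕ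
  | none => some 2
  | some none => none
  | some (some (Sum.inl k)) => some (3 * Nat.pair k 0 + 3)
  | some (some (Sum.inr (l, _))) => some (3 * l + 5)

/-- A counterexample policy for the targets `lang (some none)` and
`lang (some (some (Sum.inr (l, T))))` with `l.unpair.1 = j`. -/
def tagPolicy (j : ℕ) : Idx → Option ℕ
  | none => some (3 * j + 4)
  | some none => none
  | some (some (Sum.inl _)) => some (3 * j + 4)
  | some (some (Sum.inr (l, _))) => some (3 * l + 5)

lemma pair_value_mem_column (k : ℕ) :
    3 * Nat.pair k 0 + 3 ∈ lang (some (some (Sum.inl k))) :=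
  .inr (.inr (.inr ⟨_, rfl, by simp⟩))

lemma tag_mem_tagged (l T : ℕ) : 3 * l + 5 ∈ lang (some (some (Sum.inr (l, T)))) :=
  .inr (.inr (.inr (.inl rfl)))

lemma one_mem_column (k : ℕ) : 1 ∈ lang (some (some (Sum.inl k))) := .inr (.inl rfl)

lemma one_mem_tagged (l T : ℕ) : 1 ∈ lang (some (some (Sum.inr (l, T)))) := .inr (.inl rfl)

lemma admissible_columnPolicy_singleton (s : Idx) :
    Admissible (lang (some none)) (lang s) (columnPolicy s) := by
  rcases s with _ | _ | k | ⟨l, T⟩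
  · exact .of_mem (.inr (.inl rfl)) (by simp [lang])
  · exact .of_subset subset_rfl
  · exact .of_mem (pair_value_mem_column k) (by simp [lang])
  · exact .of_mem (tag_mem_tagged l T) (by simp [lang])

lemma admissible_tagPolicy_singleton (j : ℕ) (s : Idx) :
    Admissible (lang (some none)) (lang s) (tagPolicy j s) := by
  rcases s with _ | _ | k | ⟨l, T⟩
  · exact .of_mem (.inr (.inr ⟨j, rfl⟩)) (by simp [lang])
  · exact .of_subset subset_rfl
  · exact .of_mem (.inr (.inr (.inl ⟨j, rfl⟩))) (by simp [lang])
  · exact .of_mem (tag_mem_tagged l T) (by simp [lang])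

lemma admissible_columnPolicy_column {k : ℕ} {s : Idx} (h : s ≠ some (some (Sum.inl k))) :
    Admissible (lang (some (some (Sum.inl k)))) (lang s) (columnPolicy s) := by
  rcases s with _ | _ | k' | ⟨l, T⟩
  · exact .of_mem (.inr (.inl rfl)) (by rintro (h | h | ⟨j, h⟩ | ⟨j, h, -⟩) <;> omega)
  · exact .of_subset (by rintro _ rfl; exact one_mem_column k)
  · refine .of_mem (pair_value_mem_column k') ?_
    rintro (e | e | ⟨j, e⟩ | ⟨j, e, hj⟩)
    · omega
    · omega
    · omega
    · obtain rfl : Nat.pair k' 0 = j := by omega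
      simp only [Nat.unpair_pair] at hj
      exact h (by rw [hj])
  · exact .of_mem (tag_mem_tagged l T) (by rintro (h | h | ⟨j, h⟩ | ⟨j, h, -⟩) <;> omega)

lemma tag_notMem_tagged {l l' T : ℕ} (h : l' ≠ l) :
    3 * l' + 5 ∉ lang (some (some (Sum.inr (l, T)))) := by
  rintro (e | e | e | e | ⟨j, e, -⟩ | ⟨j, e, -⟩) <;> omega

lemma admissible_columnPolicy_tagged {k l T : ℕ} {s : Idx} (h : s ≠ none)
    (hk : s ≠ some (some (Sum.inl k))) (hl : ∀ T, s ≠ some (some (Sum.inr (l, T))))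
    (hT : ∀ i, T.testBit i = true → i.unpair.1 = k) :
    Admissible (lang (some (some (Sum.inr (l, T))))) (lang s) (columnPolicy s) := by
  rcases s with _ | _ | k' | ⟨l', T'⟩
  · exact absurd rfl h
  · exact .of_subset (by rintro _ rfl; exact one_mem_tagged l T)
  · refine .of_mem (pair_value_mem_column k') ?_
    rintro (e | e | e | e | ⟨j, e, -⟩ | ⟨j, e, hj⟩)
    · omega
    · omega
    · omega
    · omega
    · omega
    · obtain rfl : Nat.pair k' 0 = j := by omega
      have := hT _ hj
      simp only [Nat.unpair_pair] at this
      exact hk (by rw [this])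
  · exact .of_mem (tag_mem_tagged l' T') (tag_notMem_tagged fun e => hl T' (by rw [e]))

lemma admissible_tagPolicy_tagged {j l T : ℕ} {s : Idx} (hj : l.unpair.1 = j)
    (hl : ∀ T, s ≠ some (some (Sum.inr (l, T)))) :
    Admissible (lang (some (some (Sum.inr (l, T))))) (lang s) (tagPolicy j s) := by
  have hz : 3 * j + 4 ∉ lang (some (some (Sum.inr (l, T)))) := by
    rintro (e | e | e | e | ⟨i, e, hi⟩ | ⟨i, e, -⟩) <;> omega
  rcases s with _ | _ | k' | ⟨l', T'⟩
  · exact .of_mem (.inr (.inr ⟨j, rfl⟩)) hz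
  · exact .of_subset (by rintro _ rfl; exact one_mem_tagged l T)
  · exact .of_mem (.inr (.inr (.inl ⟨j, rfl⟩))) hz
  · exact .of_mem (tag_mem_tagged l' T') (tag_notMem_tagged fun e => hl T' (by rw [e]))

/-- Against a policy that is admissible for `lang (some none)`, the engine reaches the state
`some none` after finitely many inputs with value `1`. -/
lemma Identifies.exists_policyRun_eq_singleton (hid : Identifies G s₀)
    (hc : ∀ s, Admissible (lang (some none)) (lang s) (c s)) :
    ∃ σ, policyRun G c s₀ σ = some none ∧ ∀ v, some v ∈ σ → v = 1 := by
  obtain ⟨N, hN⟩ := hid (some none) (fun _ => some 1)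
    (fun n => c (policyRun G c s₀ (latestFirst (fun _ => some 1) n)))
    (fun n => policyRun G c s₀ (latestFirst (fun _ => some 1) n)) rfl (fun _ => rfl)
    (Set.ext fun v => ⟨fun ⟨_, h⟩ => (Option.some.inj h).symm, fun h => ⟨0, congrArg some h.symm⟩⟩)
    (fun n => hc _)
  refine ⟨_, hN N le_rfl, ?_⟩
  clear hN
  induction N with
  | zero => simp [latestFirst]
  | succ N ih => simpa [latestFirst] using ih

lemma Identifies.exists_legal_column (hid : Identifies G s₀) :
    ∃ k h, run G s₀ h = some none ∧ Legal G s₀ (lang (some (some (Sum.inl k)))) h := by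
  obtain ⟨σ, hσ, hone⟩ := hid.exists_policyRun_eq_singleton admissible_columnPolicy_singleton
  obtain ⟨B, hB⟩ := exists_along_ne_column (G := G) (c := columnPolicy) (s := s₀) σ
  obtain ⟨k, hk⟩ := Infinite.exists_notMem_finset B
  refine ⟨k, policyHistory G columnPolicy s₀ σ, run_policyHistory.trans hσ, Along.legal ?_⟩
  refine ((hB k hk).and (Along.of_mem (P := fun _ x => ∀ v, x = some v → v = 1) ?_)).imp ?_
  · rintro x hx _ v rfl
    exact hone v hx
  · exact fun s x h => ⟨fun v hv => h.2 v hv ▸ one_mem_column k,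
      admissible_columnPolicy_column h.1⟩

lemma Identifies.exists_legal_tagged (hid : Identifies G s₀) (j : ℕ) :
    ∃ h, run G s₀ h = some none ∧ ∃ B : Finset ℕ, ∀ l ∉ B, l.unpair.1 = j →
      ∀ T, Legal G s₀ (lang (some (some (Sum.inr (l, T))))) h := by
  obtain ⟨σ, hσ, hone⟩ :=
    hid.exists_policyRun_eq_singleton (admissible_tagPolicy_singleton j)
  obtain ⟨B, hB⟩ := exists_along_ne_tag (G := G) (c := tagPolicy j) (s := s₀) σ
  refine ⟨policyHistory G (tagPolicy j) s₀ σ, run_policyHistory.trans hσ, B,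
    fun l hl hj T => Along.legal ?_⟩
  refine ((hB l hl).and (Along.of_mem (P := fun _ x => ∀ v, x = some v → v = 1) ?_)).imp ?_
  · rintro x hx _ v rfl
    exact hone v hx
  · exact fun s x h => ⟨fun v hv => h.2 v hv ▸ one_mem_tagged l T,
      admissible_tagPolicy_tagged hj h.1⟩

lemma mem_tagged_add_two_pow {l T t v : ℕ} (ht : T.testBit t = false) :
    v ∈ lang (some (some (Sum.inr (l, T + 2 ^ t)))) ↔
      v ∈ lang (some (some (Sum.inr (l, T)))) ∨ v = 3 * t + 3 := by
  simp only [lang, Set.mem_ofPred_eq, testBit_add_two_pow ht, Bool.or_eq_true, decide_eq_true_eq,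
    and_or_left, exists_or, exists_eq_right', or_assoc]

/-- A state cannot be reached both legally for `lang (some (some (Sum.inr (l, T))))` and, with
`3 * t + 3` among the inputs, legally for `T ∪ {t}`, when `t` is large. -/
lemma Identifies.not_legal_of_run_eq (hid : Identifies G s₀) {l T : ℕ}
    {h : List (Option ℕ × Option ℕ)}
    (hh : Legal G s₀ (lang (some (some (Sum.inr (l, T))))) h) :
    ∃ B, ∀ t ≥ B, T.testBit t = false → ∀ h', run G s₀ h' = run G s₀ h →
      (∃ u ∈ h', u.1 = some (3 * t + 3)) →
      ¬ Legal G s₀ (lang (some (some (Sum.inr (l, T + 2 ^ t))))) h' := by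
  classical
  choose c hc using fun s => exists_admissible (lang (some (some (Sum.inr (l, T))))) (lang s)
  set L := lang (some (some (Sum.inr (l, T)))) with hL
  set xs : ℕ → Option ℕ := fun n => if n ∈ L then some n else none with hxs
  set w : ℕ → Idx := fun n => policyRun G c (run G s₀ h) (latestFirst xs n) with hw
  have hmem : ∀ n v, xs n = some v → v ∈ L := by
    intro n v hv
    by_cases hn : n ∈ L
    · simp only [hxs, hn, if_true, Option.some.injEq] at hv
      rwa [← hv]
    · simp [hxs, hn] at hv
  have hall : ∀ v ∈ L, ∃ n, xs n = some v := fun v hv => ⟨v, if_pos hv⟩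
  obtain ⟨N, hN⟩ := hid.converges_after hh (xs := xs) (cs := fun n => c (w n)) (w := w) rfl
    (fun _ => rfl) hmem (fun v hv => .inr (hall v hv)) (fun n => hc _)
  obtain ⟨B, hB⟩ := exists_forall_mem_lt ((List.range N).map fun n => c (w n))
  refine ⟨B, fun t ht htT h' hrun ⟨u, hu, hut⟩ hleg => ?_⟩
  have hmem' : ∀ v, v ∈ lang (some (some (Sum.inr (l, T + 2 ^ t)))) ↔ v ∈ L ∨ v = 3 * t + 3 :=
    fun v => mem_tagged_add_two_pow htT
  obtain ⟨N', hN'⟩ := hid.converges_after hleg (xs := xs) (cs := fun n => c (w n)) (w := w)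
    hrun.symm (fun _ => rfl) (fun n v hv => (hmem' v).2 (.inl (hmem n v hv)))
    (fun v hv => by
      rcases (hmem' v).1 hv with hv | rfl
      · exact .inr (hall v hv)
      · exact .inl ⟨u, hu, hut⟩)
    (fun n => by
      by_cases hsub : lang (w n) ⊆ L
      · rw [(hc (w n)).1 hsub]
        exact .of_subset fun v hv => (hmem' v).2 (.inl (hsub hv))
      · obtain ⟨m, hm, hmK, hmL⟩ := (hc (w n)).2 hsub
        rw [hm]
        refine .of_mem hmK fun e => ?_
        have hnN : n < N := by
          by_contra hn
          exact hsub (by rw [hN n (by omega)])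
        have := hB m (List.mem_map.2 ⟨n, List.mem_range.2 hnN, hm⟩)
        rcases (hmem' m).1 e with e | e
        · exact hmL e
        · omega)
  have h1 := hN (max N N') (le_max_left _ _)
  rw [hN' (max N N') (le_max_right _ _)] at h1
  simp only [Option.some.injEq, Sum.inr.injEq, Prod.mk.injEq, true_and] at h1
  have := Nat.two_pow_pos t
  omega

/-- The column phase avoids the states `none` and `some (some (Sum.inl k))`, and its inputs belong
to `lang (some (some (Sum.inl k)))`. -/
def ColumnPhase (G : Idx → Option ℕ → Option ℕ → Idx) (k : ℕ) (σ : List (Option ℕ)) : Prop :=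
  Along G columnPolicy (some none) (fun s x => (s ≠ none ∧ s ≠ some (some (Sum.inl k))) ∧
    ∀ v, x = some v → v ∈ lang (some (some (Sum.inl k)))) σ

/-- The state at the end of a column phase. -/
abbrev columnRun (G : Idx → Option ℕ → Option ℕ → Idx) (σ : List (Option ℕ)) : Idx :=
  policyRun G columnPolicy (some none) σ

lemma ColumnPhase.legal_tagged {k l T : ℕ} (h : ColumnPhase G k σ)
    (hl : Along G columnPolicy (some none) (fun s _ => ∀ T, s ≠ some (some (Sum.inr (l, T)))) σ)
    (hT : ∀ i, T.testBit i = true → i.unpair.1 = k)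
    (hmem : ∀ v, some v ∈ σ → v ∈ lang (some (some (Sum.inr (l, T))))) :
    Legal G (some none) (lang (some (some (Sum.inr (l, T)))))
      (policyHistory G columnPolicy (some none) σ) := by
  refine Along.legal (((Along.and h hl).and (Along.of_mem
    (P := fun _ x => ∀ v, x = some v → v ∈ lang (some (some (Sum.inr (l, T))))) ?_)).imp ?_)
  · rintro x hx _ v rfl
    exact hmem v hx
  · exact fun s x h => ⟨h.2, admissible_columnPolicy_tagged h.1.1.1.1 h.1.1.1.2 h.1.2 hT⟩

lemma ColumnPhase.mem {k v : ℕ} (h : ColumnPhase G k σ) (hv : some v ∈ σ) :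
    v ∈ lang (some (some (Sum.inl k))) := by
  induction σ with
  | nil => simp at hv
  | cons x σ ih =>
    rcases List.mem_cons.1 hv with rfl | hv
    exacts [h.2.2 v rfl, ih h.1 hv]

lemma exists_code (S : Finset ℕ) : ∃ T : ℕ, ∀ i, T.testBit i = true ↔ i ∈ S := by
  induction S using Finset.induction_on with
  | empty => exact ⟨0, by simp⟩
  | insert a S _ ih =>
    obtain ⟨T, hT⟩ := ih
    exact ⟨insertBit T a, fun i => by
      rw [testBit_insertBit, Bool.or_eq_true, hT, decide_eq_true_eq, Finset.mem_insert, or_comm,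
        eq_comm]⟩

lemma mem_tagged_of_mem_column {k l T M v : ℕ} (hv : v ∈ lang (some (some (Sum.inl k))))
    (hM : v < M) (hl : l.unpair.1 = M) (hT : ∀ i < M, i.unpair.1 = k → T.testBit i = true) :
    v ∈ lang (some (some (Sum.inr (l, T)))) := by
  rcases hv with h | h | ⟨j, h⟩ | ⟨i, h, hi⟩
  · exact .inl h
  · exact .inr (.inl h)
  · exact .inr (.inr (.inr (.inr (.inl ⟨j, h, by omega⟩))))
  · exact .inr (.inr (.inr (.inr (.inr ⟨i, h, hT i (by omega) hi⟩))))

lemma exists_pair_notMem (B : Finset ℕ) (M : ℕ) : ∃ n, ∀ m ≥ n, Nat.pair M m ∉ B := by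
  refine ⟨B.sup id + 1, fun m hm h => ?_⟩
  have h1 : Nat.pair M m ≤ B.sup id := Finset.le_sup (f := id) h
  have h2 := Nat.right_le_pair M m
  omega

/-- The column phase can be prolonged by a new value of the column followed by a prescribed
input, without entering a forbidden state. -/
lemma Identifies.exists_columnPhase_cons (hid : Identifies G s₀) {k : ℕ} {e : Option ℕ}
    (he : ∀ v, e = some v → v ∈ lang (some (some (Sum.inl k)))) (hσ : ColumnPhase G k σ)
    (hend : columnRun G σ ≠ none ∧ columnRun G σ ≠ some (some (Sum.inl k))) :
    ∃ t, ColumnPhase G k (e :: some (3 * t + 3) :: σ) ∧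
      columnRun G (e :: some (3 * t + 3) :: σ) ≠ none ∧
      columnRun G (e :: some (3 * t + 3) :: σ) ≠ some (some (Sum.inl k)) := by
  classical
  obtain ⟨S, hS⟩ : ∃ S : Idx → List (Option ℕ), ∀ f, (∃ σ, ColumnPhase G k σ ∧ columnRun G σ = f) →
      ColumnPhase G k (S f) ∧ columnRun G (S f) = f := by
    have : ∀ f, ∃ τ, (∃ σ, ColumnPhase G k σ ∧ columnRun G σ = f) →
        ColumnPhase G k τ ∧ columnRun G τ = f := fun f => by
      by_cases h : ∃ σ, ColumnPhase G k σ ∧ columnRun G σ = f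
      · exact ⟨h.choose, fun _ => h.choose_spec⟩
      · exact ⟨[], fun h' => absurd h' h⟩
    exact ⟨fun f => (this f).choose, fun f => (this f).choose_spec⟩
  obtain ⟨M, hM⟩ := exists_forall_mem_lt
    (e :: (σ ++ (S none ++ S (some (some (Sum.inl k))))))
  obtain ⟨h₂, hrun₂, B₂, hB₂⟩ := hid.exists_legal_tagged M
  obtain ⟨B, hB⟩ := exists_along_ne_tag (G := G) (c := columnPolicy) (s := some none) (none :: σ)
  obtain ⟨B', hB'⟩ := exists_along_ne_tag (G := G) (c := columnPolicy) (s := some none) (S none)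
  obtain ⟨B'', hB''⟩ := exists_along_ne_tag (G := G) (c := columnPolicy) (s := some none)
    (S (some (some (Sum.inl k))))
  obtain ⟨n, hn⟩ := exists_pair_notMem (B₂ ∪ (B ∪ (B' ∪ B''))) M
  simp only [Finset.mem_union, not_or] at hn
  obtain ⟨T, hT⟩ := exists_code ((Finset.range M).filter fun i => i.unpair.1 = k)
  simp only [Finset.mem_filter, Finset.mem_range] at hT
  have hF : ∀ f m, ∃ b, (f = none ∨ f = some (some (Sum.inl k))) → n ≤ m → ∀ t ≥ b,
      t.unpair.1 = k → M ≤ t → ∀ σ', ColumnPhase G k σ' → columnRun G σ' = f →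
      Along G columnPolicy (some none)
        (fun s _ => ∀ T, s ≠ some (some (Sum.inr (Nat.pair M m, T)))) σ' →
      some (3 * t + 3) ∈ σ' → (∀ v, some v ∈ σ' → v < M ∨ v = 3 * t + 3) → False := by
    intro f m
    by_cases hf : ((f = none ∨ f = some (some (Sum.inl k))) ∧ n ≤ m) ∧
        ∃ σ, ColumnPhase G k σ ∧ columnRun G σ = f
    · obtain ⟨⟨hf, hnm⟩, hex⟩ := hf
      obtain ⟨hSf, hrunS⟩ := hS f hex
      have hm := hn m hnm
      have hA : Legal G s₀ (lang (some (some (Sum.inr (Nat.pair M m, T)))))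
          (policyHistory G columnPolicy (some none) (S f) ++ h₂) := by
        refine (hB₂ _ hm.1 (by simp) T).append ?_
        rw [hrun₂]
        refine hSf.legal_tagged ?_ (fun i hi => ((hT i).1 hi).2) fun v hv =>
          mem_tagged_of_mem_column (hSf.mem hv) (hM v ?_) (by simp)
            fun i hi hik => (hT i).2 ⟨hi, hik⟩
        · rcases hf with rfl | rfl
          exacts [hB' _ hm.2.2.1, hB'' _ hm.2.2.2]
        · rcases hf with rfl | rfl <;> simp [hv]
      obtain ⟨b, hb⟩ := hid.not_legal_of_run_eq hA
      refine ⟨b, fun _ _ t ht htk htM σ' hσ' hrun' htag hmem hval => ?_⟩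
      have htT : T.testBit t = false := by
        rw [← Bool.not_eq_true, hT]
        omega
      obtain ⟨u, hu, hut⟩ := exists_mem_policyHistory (G := G) (c := columnPolicy)
        (s := some none) hmem
      refine hb t ht htT (policyHistory G columnPolicy (some none) σ' ++ h₂) ?_
        ⟨u, List.mem_append_left _ hu, hut⟩ ((hB₂ _ hm.1 (by simp) _).append ?_)
      · rw [run_append, run_append, hrun₂, run_policyHistory, run_policyHistory]
        exact hrun'.trans hrunS.symm
      · rw [hrun₂]
        refine hσ'.legal_tagged htag (fun i hi => ?_) fun v hv => ?_
        · rw [testBit_add_two_pow htT, Bool.or_eq_true, hT, decide_eq_true_eq] at hi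
          rcases hi with hi | rfl
          exacts [hi.2, htk]
        · rw [mem_tagged_add_two_pow htT]
          refine (hval v hv).imp_left fun hvM => ?_
          exact mem_tagged_of_mem_column (hσ'.mem hv) hvM (by simp)
            fun i hi hik => (hT i).2 ⟨hi, hik⟩
    · exact ⟨0, fun h1 h2 t _ _ _ σ' h3 h4 => absurd ⟨⟨h1, h2⟩, σ', h3, h4⟩ hf⟩
  choose b hb using hF
  set t := Nat.pair k (M + b none n + b none (n + 1) + b (some (some (Sum.inl k))) n +
    b (some (some (Sum.inl k))) (n + 1)) with ht
  have htle := Nat.right_le_pair k (M + b none n + b none (n + 1) +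
    b (some (some (Sum.inl k))) n + b (some (some (Sum.inl k))) (n + 1))
  rw [← ht] at htle
  have htk : t.unpair.1 = k := by simp [ht]
  have htb : ∀ f m, (f = none ∨ f = some (some (Sum.inl k))) → (m = n ∨ m = n + 1) →
      b f m ≤ t := by
    rintro f m (rfl | rfl) (rfl | rfl) <;> omega
  have hvalσ : ∀ v, some v ∈ σ → v < M := fun v hv => hM v (by simp [hv])
  have h1 : ColumnPhase G k (some (3 * t + 3) :: σ) := by
    refine ⟨hσ, hend, ?_⟩
    rintro v ⟨⟩
    exact .inr (.inr (.inr ⟨t, rfl, htk⟩))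
  have hend1 : ∀ f, (f = none ∨ f = some (some (Sum.inl k))) →
      columnRun G (some (3 * t + 3) :: σ) ≠ f := fun f hf hrun => by
    have hm := hn n le_rfl
    refine hb f n hf le_rfl t (htb f n hf (.inl rfl)) htk (by omega) _ h1 hrun
      (hB _ hm.2.1) List.mem_cons_self fun v hv => ?_
    rcases List.mem_cons.1 hv with hv | hv
    · exact .inr (Option.some.inj hv)
    · exact .inl (hvalσ v hv)
  have h2 : ColumnPhase G k (e :: some (3 * t + 3) :: σ) :=
    ⟨h1, ⟨hend1 _ (.inl rfl), hend1 _ (.inr rfl)⟩, he⟩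
  have hend2 : ∀ f, (f = none ∨ f = some (some (Sum.inl k))) →
      columnRun G (e :: some (3 * t + 3) :: σ) ≠ f := fun f hf hrun => by
    obtain ⟨m, hm, hne⟩ : ∃ m, (m = n ∨ m = n + 1) ∧ ∀ T,
        columnRun G (some (3 * t + 3) :: σ) ≠ some (some (Sum.inr (Nat.pair M m, T))) := by
      by_cases hne : ∀ T,
          columnRun G (some (3 * t + 3) :: σ) ≠ some (some (Sum.inr (Nat.pair M n, T)))
      · exact ⟨n, .inl rfl, hne⟩
      · push Not at hne
        obtain ⟨T', hT'⟩ := hne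
        refine ⟨n + 1, .inr rfl, fun T'' => ?_⟩
        rw [hT']
        simp
    have hnm : n ≤ m := by omega
    refine hb f m hf hnm t (htb f m hf hm) htk (by omega) _ h2 hrun
      ⟨hB _ (hn m hnm).2.1, hne⟩ (by simp) fun v hv => ?_
    rcases List.mem_cons.1 hv with hv | hv
    · exact .inl (hM v (by simp [hv]))
    rcases List.mem_cons.1 hv with hv | hv
    · exact .inr (Option.some.inj hv)
    · exact .inl (hvalσ v hv)
  exact ⟨t, h2, hend2 _ (.inl rfl), hend2 _ (.inr rfl)⟩

theorem not_identifies (G : Idx → Option ℕ → Option ℕ → Idx) (s₀ : Idx) : ¬ Identifies G s₀ := by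
  classical
  intro hid
  obtain ⟨k, h, hrun, hleg⟩ := hid.exists_legal_column
  set e : ℕ → Option ℕ := fun n => if n ∈ lang (some (some (Sum.inl k))) then some n else none
    with he
  have hemem : ∀ n v, e n = some v → v ∈ lang (some (some (Sum.inl k))) := by
    intro n v hv
    by_cases hn : n ∈ lang (some (some (Sum.inl k)))
    · simp only [he, hn, if_true, Option.some.injEq] at hv
      rwa [← hv]
    · simp [he, hn] at hv
  have hstep := fun (σ : List (Option ℕ)) (n : ℕ) (hσ : ColumnPhase G k σ ∧
    columnRun G σ ≠ none ∧ columnRun G σ ≠ some (some (Sum.inl k))) =>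
      hid.exists_columnPhase_cons (hemem n) hσ.1 hσ.2
  choose! t ht using hstep
  set ρ : ℕ → List (Option ℕ) := fun n =>
    Nat.rec [] (fun n σ => e n :: some (3 * t σ n + 3) :: σ) n with hρ
  have hρs : ∀ n, ρ (n + 1) = e n :: some (3 * t (ρ n) n + 3) :: ρ n := fun n => rfl
  have hphase : ∀ n, ColumnPhase G k (ρ n) ∧
      columnRun G (ρ n) ≠ none ∧ columnRun G (ρ n) ≠ some (some (Sum.inl k)) := by
    intro n
    induction n with
    | zero => exact ⟨trivial, by simp [hρ, policyRun], by simp [hρ, policyRun]⟩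
    | succ n ih => exact ht (ρ n) n ih
  set xs : ℕ → Option ℕ := fun m =>
    if m % 2 = 0 then some (3 * t (ρ (m / 2)) (m / 2) + 3) else e (m / 2) with hxs
  have hxse : ∀ n, xs (2 * n) = some (3 * t (ρ n) n + 3) := fun n => by simp [hxs]
  have hxso : ∀ n, xs (2 * n + 1) = e n := fun n => by
    have h1 : (2 * n + 1) % 2 ≠ 0 := by omega
    have h2 : (2 * n + 1) / 2 = n := by omega
    simp only [hxs, h1, if_false, h2]
  have hlatest : ∀ n, latestFirst xs (2 * n) = ρ n := by
    intro n
    induction n with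
    | zero => rfl
    | succ n ih =>
      rw [hρs, show 2 * (n + 1) = 2 * n + 1 + 1 by ring, latestFirst, latestFirst, ih, hxse, hxso]
  have hgood := fun m => along_latestFirst.1
    (show ColumnPhase G k (latestFirst xs (2 * (m + 1))) by
      rw [hlatest]; exact (hphase (m + 1)).1) m
    (by omega)
  obtain ⟨N, hN⟩ := hid.converges_after hleg (xs := xs)
    (cs := fun n => columnPolicy (columnRun G (latestFirst xs n)))
    (w := fun n => columnRun G (latestFirst xs n)) hrun.symm (fun _ => rfl)
    (fun n v hv => (hgood n).2 v hv)
    (fun v hv => .inr ⟨2 * v + 1, (hxso v).trans (if_pos hv)⟩)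
    (fun n => admissible_columnPolicy_column (hgood n).1.2)
  exact (hgood N).1.2 (hN N le_rfl)

end Game

/-- HCEGIS ⊄ CEGIS. There is an indexed family identified by some
HCEGIS engine but by no CEGIS engine. -/
theorem hcegis_not_subset_cegis :
    ∃ Lfam : ℕ → Set ℕ, IsIndexedFamily Lfam ∧ InHCEGIS Lfam ∧ ¬ InCEGIS Lfam := by
  refine ⟨langFamily, isIndexedFamily_langFamily, inHCEGIS_langFamily, ?_⟩
  rintro ⟨F, p₀, -, h⟩
  exact not_identifies _ _ (identifies_of_cegisIdentifies h)
end
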